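/- Let W be an r×r symmetric positive definite matrix, C ⊆ {1,...,r}, and A, B ⊆ {1,...,r}\C with |A∪C| = |B∪C|. Let W̄ = W_{C'×C'} − W_{C'×C} W_{C×C}^{-1} W_{C×C'} be the Schur complement, where C' = {1,...,r}\C. Then det(W_{(A∪C)×(B∪C)}) = det(W_{C×C}) · det(W̄_{A×B}). -/

import Mathlib

open Matrix Finset

/-- The determinant of a submatrix indexed by `e ⊕ a` and `f ⊕ b` factors through the Schur
complement of the invertible block `W.submatrix e f`. -/
theorem Matrix.det_submatrix_sumElim {R l m n o : Type*} [CommRing R]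
    [Fintype m] [DecidableEq m] [Fintype n] [DecidableEq n]
    (W : Matrix l o R) (e : m → l) (f : m → o) (a : n → l) (b : n → o)
    (h : IsUnit (W.submatrix e f)) :
    (W.submatrix (Sum.elim e a) (Sum.elim f b)).det
      = (W.submatrix e f).det
        * ((W - W.submatrix id f * (W.submatrix e f)⁻¹ * W.submatrix e id).submatrix a b).det := by
  let := h.invertible
  have hblocks : W.submatrix (Sum.elim e a) (Sum.elim f b) = fromBlocks (W.submatrix e f)
      (W.submatrix e b) (W.submatrix a f) (W.submatrix a b) := by
    ext (i | i) (j | j) <;> rfl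
  rw [hblocks, det_fromBlocks₁₁, invOf_eq_nonsing_inv]
  rfl

theorem det_submatrix_schur_complement_factorization
    {r k : ℕ} (W : Matrix (Fin r) (Fin r) ℝ) (hW : W.PosDef)
    (C : Finset (Fin r)) {c : ℕ} (hC : C.card = c)
    (a b : Fin k → Fin r)
    (ha : Function.Injective a) (hb : Function.Injective b)
    (haC : ∀ i, a i ∉ C) (hbC : ∀ i, b i ∉ C) :
    (W.submatrix (Sum.elim (fun i : Fin c => C.orderEmbOfFin hC i) a)
        (Sum.elim (fun i : Fin c => C.orderEmbOfFin hC i) b)).det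
      = (W.submatrix (fun i : Fin c => C.orderEmbOfFin hC i)
            (fun i : Fin c => C.orderEmbOfFin hC i)).det
        * ((W - W.submatrix id (fun i : Fin c => C.orderEmbOfFin hC i)
              * (W.submatrix (fun i : Fin c => C.orderEmbOfFin hC i)
                  (fun i : Fin c => C.orderEmbOfFin hC i))⁻¹
              * W.submatrix (fun i : Fin c => C.orderEmbOfFin hC i) id).submatrix a b).det := by
  exact det_submatrix_sumElim W _ _ a b
    (hW.submatrix (C.orderEmbOfFin hC).injective).isUnit
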